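/- arXiv:2409.10886 — 3 statements merged into one kernel-verified Lean document; each statement's English description precedes it below -/
import Mathlib

section
/- Fix an integer K ≥ 3. There exists a constant C_K > 0 depending only on K such that for all integers n ≥ 1, d ≥ 1, 0 ≤ ℓ ≤ d, and every ℓ-support-homogeneous polynomial f : Ω_K^n → ℂ of degree at most d, one has (∑_α |f̂(α)|^{2d/(d+1)})^{(d+1)/(2d)} ≤ C_K^d · sup_{z ∈ Ω_K^n} |f(z)|. -/
open Finset

/-- The support of a multi-index `α ∈ {0,…,K-1}ⁿ`. -/
def msupp {n K : ℕ} (α : Fin n → Fin K) : Finset (Fin n) :=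
  Finset.univ.filter fun j => (α j : ℕ) ≠ 0

/-- The Walsh character indexed by `S`, at the sign vector equal to `-1` exactly on `T`. -/
def walsh {ι : Type*} [DecidableEq ι] (T S : Finset ι) : ℝ :=
  ∏ i ∈ S, if i ∈ T then -1 else 1

theorem walsh_insert_left {ι : Type*} [DecidableEq ι] {a : ι} {S : Finset ι} (T : Finset ι)
    (ha : a ∉ S) : walsh (insert a T) S = walsh T S := by
  refine prod_congr rfl fun i hi => ?_
  have : i ≠ a := fun h => ha (h ▸ hi)
  simp [this]

theorem walsh_insert_right {ι : Type*} [DecidableEq ι] {a : ι} {S T : Finset ι}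
    (ha : a ∉ S) (haT : a ∉ T) : walsh T (insert a S) = walsh T S := by
  simp [walsh, prod_insert ha, haT]

theorem walsh_insert_insert {ι : Type*} [DecidableEq ι] {a : ι} {S : Finset ι} (T : Finset ι)
    (ha : a ∉ S) : walsh (insert a T) (insert a S) = -walsh T S := by
  rw [← walsh_insert_left T ha]
  simp [walsh, prod_insert ha]

/-- Splitting off the variable `a` from the sum of a function of a Walsh polynomial. -/
theorem sum_walsh_insert {ι : Type*} [DecidableEq ι] {a : ι} {s : Finset ι} (ha : a ∉ s)
    (g : Finset ι → ℝ) (F : ℝ → ℝ) :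
    ∑ T ∈ (insert a s).powerset, F (∑ S ∈ (insert a s).powerset, g S * walsh T S) =
      ∑ T ∈ s.powerset,
        (F (∑ S ∈ s.powerset, g S * walsh T S + ∑ S ∈ s.powerset, g (insert a S) * walsh T S) +
         F (∑ S ∈ s.powerset, g S * walsh T S - ∑ S ∈ s.powerset, g (insert a S) * walsh T S)) := by
  rw [sum_powerset_insert ha, ← sum_add_distrib]
  refine sum_congr rfl fun T hT => ?_
  have haT : a ∉ T := fun h => ha (mem_powerset.1 hT h)
  rw [sum_powerset_insert ha, sum_powerset_insert ha, sub_eq_add_neg, ← sum_neg_distrib]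
  have hS : ∀ S ∈ s.powerset, a ∉ S := fun S hS h => ha (mem_powerset.1 hS h)
  congr 3
  · exact sum_congr rfl fun S h => by rw [walsh_insert_right (hS S h) haT]
  · exact sum_congr rfl fun S h => by rw [walsh_insert_left _ (hS S h)]
  · exact sum_congr rfl fun S h => by rw [walsh_insert_insert _ (hS S h), mul_neg]

theorem sum_walsh_sq {ι : Type*} [DecidableEq ι] (s : Finset ι) (g : Finset ι → ℝ) :
    ∑ T ∈ s.powerset, (∑ S ∈ s.powerset, g S * walsh T S) ^ 2 =
      2 ^ #s * ∑ S ∈ s.powerset, g S ^ 2 := by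
  induction s using Finset.induction_on generalizing g with
  | empty => simp [walsh]
  | insert a s ha ih =>
    rw [sum_walsh_insert ha g (fun x => x ^ 2), sum_powerset_insert ha, card_insert_of_notMem ha]
    have h1 := ih g
    have h2 := ih fun S => g (insert a S)
    have : ∀ y z : ℝ, (y + z) ^ 2 + (y - z) ^ 2 = 2 * y ^ 2 + 2 * z ^ 2 := fun y z => by ring
    simp only [this, sum_add_distrib, ← mul_sum, h1, h2]
    ring

/-- Bonami's hypercontractive inequality from `L²` to `L⁴`. -/
theorem sum_walsh_pow_four_le {ι : Type*} [DecidableEq ι] (s : Finset ι) (g : Finset ι → ℝ) :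
    ∑ T ∈ s.powerset, (∑ S ∈ s.powerset, g S * walsh T S) ^ 4 ≤
      2 ^ #s * (∑ S ∈ s.powerset, 3 ^ #S * g S ^ 2) ^ 2 := by
  induction s using Finset.induction_on generalizing g with
  | empty => simp [walsh]; apply le_of_eq; ring
  | insert a s ha ih =>
    rw [sum_walsh_insert ha g (fun x => x ^ 4), sum_powerset_insert ha, card_insert_of_notMem ha]
    have h1 := ih g
    have h2 := ih fun S => g (insert a S)
    have h3 : ∑ S ∈ s.powerset, (3 : ℝ) ^ #(insert a S) * g (insert a S) ^ 2 =
        3 * ∑ S ∈ s.powerset, (3 : ℝ) ^ #S * g (insert a S) ^ 2 := by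
      rw [mul_sum]
      refine sum_congr rfl fun S hS => ?_
      rw [card_insert_of_notMem fun h => ha (mem_powerset.1 hS h)]
      ring
    rw [h3]
    set A := ∑ S ∈ s.powerset, (3 : ℝ) ^ #S * g S ^ 2
    set B := ∑ S ∈ s.powerset, (3 : ℝ) ^ #S * g (insert a S) ^ 2
    have hA : 0 ≤ A := sum_nonneg fun _ _ => by positivity
    have hB : 0 ≤ B := sum_nonneg fun _ _ => by positivity
    set Y : Finset ι → ℝ := fun T => ∑ S ∈ s.powerset, g S * walsh T S
    set Z : Finset ι → ℝ := fun T => ∑ S ∈ s.powerset, g (insert a S) * walsh T S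
    have hYZ : ∑ T ∈ s.powerset, Y T ^ 2 * Z T ^ 2 ≤ 2 ^ #s * (A * B) := by
      refine abs_le_of_sq_le_sq' ?_ (by positivity) |>.2
      calc (∑ T ∈ s.powerset, Y T ^ 2 * Z T ^ 2) ^ 2
          ≤ (∑ T ∈ s.powerset, (Y T ^ 2) ^ 2) * ∑ T ∈ s.powerset, (Z T ^ 2) ^ 2 :=
            sum_mul_sq_le_sq_mul_sq _ _ _
        _ = (∑ T ∈ s.powerset, Y T ^ 4) * ∑ T ∈ s.powerset, Z T ^ 4 := by
            simp only [← pow_mul]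
        _ ≤ (2 ^ #s * A ^ 2) * (2 ^ #s * B ^ 2) :=
            mul_le_mul h1 h2 (sum_nonneg fun _ _ => by positivity) (by positivity)
        _ = _ := by ring
    have : ∀ y z : ℝ, (y + z) ^ 4 + (y - z) ^ 4 = 2 * y ^ 4 + 12 * (y ^ 2 * z ^ 2) + 2 * z ^ 4 :=
      fun y z => by ring
    simp only [this, sum_add_distrib, ← mul_sum]
    change 2 * ∑ T ∈ s.powerset, Y T ^ 4 + 12 * ∑ T ∈ s.powerset, Y T ^ 2 * Z T ^ 2 +
      2 * ∑ T ∈ s.powerset, Z T ^ 4 ≤ _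
    have : 0 ≤ (2 : ℝ) ^ #s * B ^ 2 := by positivity
    calc _ ≤ 2 * (2 ^ #s * A ^ 2) + 12 * (2 ^ #s * (A * B)) + 2 * (2 ^ #s * B ^ 2) := by gcongr
      _ ≤ _ := by rw [pow_succ 2 #s]; linarith

/-- The `L²`-norm of a homogeneous Walsh polynomial is controlled by its `L¹`-norm. -/
theorem sqrt_sum_sq_le_sum_abs_walsh {ι : Type*} [DecidableEq ι] (s : Finset ι) (m : ℕ)
    (g : Finset ι → ℝ) (hg : ∀ S, #S ≠ m → g S = 0) :
    2 ^ #s * √(∑ S ∈ s.powerset, g S ^ 2) ≤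
      3 ^ m * ∑ T ∈ s.powerset, |∑ S ∈ s.powerset, g S * walsh T S| := by
  have h2 := sum_walsh_sq s g
  have h4 := sum_walsh_pow_four_le s g
  have hm : ∑ S ∈ s.powerset, 3 ^ #S * g S ^ 2 = 3 ^ m * ∑ S ∈ s.powerset, g S ^ 2 := by
    rw [mul_sum]
    refine sum_congr rfl fun S _ => ?_
    by_cases h : #S = m
    · rw [h]
    · simp [hg S h]
  rw [hm] at h4
  have hQ : 0 ≤ ∑ S ∈ s.powerset, g S ^ 2 := sum_nonneg fun _ _ => by positivity
  rw [← Real.sq_sqrt hQ] at h2 h4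
  set σ := √(∑ S ∈ s.powerset, g S ^ 2)
  set X : Finset ι → ℝ := fun T => ∑ S ∈ s.powerset, g S * walsh T S
  change ∑ T ∈ s.powerset, X T ^ 2 = _ at h2
  change ∑ T ∈ s.powerset, X T ^ 4 ≤ _ at h4
  change _ ≤ 3 ^ m * ∑ T ∈ s.powerset, |X T|
  have hσ : 0 ≤ σ := Real.sqrt_nonneg _
  rcases hσ.eq_or_lt with h0 | hpos
  · rw [← h0, mul_zero]
    positivity
  have hL : 0 < 3 ^ m * σ := by positivity
  have key : ∀ x L : ℝ, 0 < L → 3 * L ^ 2 * x ^ 2 - x ^ 4 ≤ 2 * L ^ 3 * |x| := by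
    intro x L hL
    have h : 0 ≤ |x| * ((|x| - L) ^ 2 * (|x| + 2 * L)) := by positivity
    have e2 : x ^ 2 = |x| ^ 2 := (sq_abs x).symm
    have e4 : x ^ 4 = |x| ^ 4 := by rw [show (4 : ℕ) = 2 * 2 by norm_num, pow_mul, pow_mul, sq_abs]
    rw [e2, e4]
    nlinarith [h]
  have hsum : 3 * (3 ^ m * σ) ^ 2 * ∑ T ∈ s.powerset, X T ^ 2 - ∑ T ∈ s.powerset, X T ^ 4 ≤
      2 * (3 ^ m * σ) ^ 3 * ∑ T ∈ s.powerset, |X T| := by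
    rw [mul_sum, mul_sum, ← sum_sub_distrib]
    exact sum_le_sum fun T _ => key _ _ hL
  rw [h2] at hsum
  have h5 : 2 * (3 ^ m) ^ 2 * σ ^ 3 * (2 ^ #s * σ) ≤
      2 * (3 ^ m) ^ 2 * σ ^ 3 * (3 ^ m * ∑ T ∈ s.powerset, |X T|) := by
    nlinarith [hsum, h4]
  exact le_of_mul_le_mul_left h5 (by positivity)

/-- The linear coefficient of a polynomial bounded on `[-1, 1]`. -/
theorem abs_coeff_one_le (m : ℕ) (q : ℕ → ℝ) (B : ℝ)
    (h : ∀ v : ℝ, |v| ≤ 1 → |∑ k ∈ range (m + 2), q k * v ^ k| ≤ B) :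
    |q 1| ≤ 5 ^ m * B := by
  induction m generalizing q B with
  | zero =>
    have h1 := abs_le.1 (h 1 (by norm_num))
    have h2 := abs_le.1 (h (-1) (by norm_num))
    simp [sum_range_succ] at h1 h2
    rw [pow_zero, one_mul, abs_le]
    constructor <;> linarith
  | succ m ih =>
    have h2m : (1 : ℝ) ≤ 2 ^ m := one_le_pow₀ (by norm_num)
    have hB : 0 ≤ B := (abs_nonneg _).trans (h 0 (by norm_num))
    have := ih (fun k => q k * (1 - 2 ^ (m + 2) / 2 ^ k)) ((1 + 2 ^ (m + 2)) * B) fun v hv => by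
      have e : ∑ k ∈ range (m + 2), q k * (1 - 2 ^ (m + 2) / 2 ^ k) * v ^ k =
          ∑ k ∈ range (m + 1 + 2), q k * v ^ k -
            2 ^ (m + 2) * ∑ k ∈ range (m + 1 + 2), q k * (v / 2) ^ k := by
        rw [mul_sum, ← sum_sub_distrib, sum_range_succ _ (m + 2)]
        have : q (m + 2) * v ^ (m + 2) - 2 ^ (m + 2) * (q (m + 2) * (v / 2) ^ (m + 2)) = 0 := by
          rw [div_pow]; field_simp; ring
        rw [this, add_zero]
        refine sum_congr rfl fun k _ => ?_
        rw [div_pow]; field_simp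
      rw [e]
      have hv2 : |v / 2| ≤ 1 := by rw [abs_div]; norm_num; linarith
      calc _ ≤ _ := abs_sub _ _
        _ ≤ B + 2 ^ (m + 2) * B := by
          rw [abs_mul, abs_of_nonneg (by positivity : (0 : ℝ) ≤ 2 ^ (m + 2))]
          gcongr
          · exact h v hv
          · exact h _ hv2
        _ = _ := by ring
    rw [abs_mul, show (1 : ℝ) - 2 ^ (m + 2) / 2 ^ 1 = -(2 * 2 ^ m - 1) by ring, abs_neg,
      abs_of_nonneg (by linarith : (0 : ℝ) ≤ 2 * 2 ^ m - 1)] at this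
    have h5 : (1 + 2 ^ (m + 2) : ℝ) ≤ 5 * (2 * 2 ^ m - 1) := by
      rw [pow_add]; linarith
    have h6 : |q 1| * (2 * 2 ^ m - 1) ≤ 5 ^ (m + 1) * B * (2 * 2 ^ m - 1) :=
      calc _ ≤ _ := this
        _ ≤ 5 ^ m * (5 * (2 * 2 ^ m - 1) * B) := by gcongr
        _ = _ := by ring
    exact le_of_mul_le_mul_right h6 (by linarith)

theorem abs_le_sqrt_sum_sq_mem {ι : Type*} [Fintype ι] [DecidableEq ι] (g : Finset ι → ℝ)
    {i : ι} {S : Finset ι} (hi : i ∈ S) : |g S| ≤ √(∑ S, if i ∈ S then g S ^ 2 else 0) := by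
  refine Real.abs_le_sqrt ?_
  have := single_le_sum (f := fun S => if i ∈ S then g S ^ 2 else 0)
    (fun S _ => by split_ifs <;> positivity) (mem_univ S)
  simpa [hi] using this

/-- Blei's inequality for functions on the `m`-element subsets, with all mixed norms at most one. -/
theorem sum_rpow_le_two {ι : Type*} [Fintype ι] [DecidableEq ι] (m : ℕ) (hm : 1 ≤ m)
    (g : Finset ι → ℝ) (hg : ∀ S, #S ≠ m → g S = 0)
    (hA : ∑ i, √(∑ S, if i ∈ S then g S ^ 2 else 0) ≤ 1) {p : ℝ}
    (hp : 2 * (m : ℝ) / (m + 1) ≤ p) : ∑ S, |g S| ^ p ≤ 2 := by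
  set σ : ι → ℝ := fun i => √(∑ S, if i ∈ S then g S ^ 2 else 0)
  change ∑ i, σ i ≤ 1 at hA
  have hσ : ∀ i, 0 ≤ σ i := fun i => Real.sqrt_nonneg _
  have hm0 : (0 : ℝ) < m + 1 := by positivity
  have hmR : (1 : ℝ) ≤ m := by exact_mod_cast hm
  have hp0 : 0 < p := lt_of_lt_of_le (by positivity) hp
  have hle : ∀ i S, i ∈ S → |g S| ≤ σ i := fun i S hi => abs_le_sqrt_sum_sq_mem g hi
  have key : ∀ S, |g S| ^ p ≤
      1 / (m + 1) * (∑ i, (if i ∈ S then g S ^ 2 else 0) / σ i) + 1 / (m + 1) * ∏ i ∈ S, σ i := by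
    intro S
    have hnn : 0 ≤ 1 / ((m : ℝ) + 1) * (∑ i, (if i ∈ S then g S ^ 2 else 0) / σ i) +
        1 / (m + 1) * ∏ i ∈ S, σ i := by
      refine add_nonneg (mul_nonneg (by positivity) (sum_nonneg fun i _ => ?_))
        (mul_nonneg (by positivity) (prod_nonneg fun i _ => hσ i))
      exact div_nonneg (by split_ifs <;> positivity) (hσ i)
    by_cases h0 : g S = 0
    · refine le_trans (le_of_eq ?_) hnn
      rw [h0, abs_zero, Real.zero_rpow hp0.ne']
    have hc : #S = m := by by_contra h; exact h0 (hg S h)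
    have hgpos : 0 < |g S| := abs_pos.2 h0
    have hσpos : ∀ i ∈ S, 0 < σ i := fun i hi => hgpos.trans_le (hle i S hi)
    have hg1 : |g S| ≤ 1 := by
      obtain ⟨i, hi⟩ := card_pos.1 (by omega : 0 < #S)
      exact (hle i S hi).trans ((single_le_sum (fun i _ => hσ i) (mem_univ i)).trans hA)
    have amgm := Real.geom_mean_le_arith_mean_weighted (insertNone S)
      (fun _ => 1 / ((m : ℝ) + 1))
      (fun o => o.elim (∏ i ∈ S, σ i) fun i => g S ^ 2 / σ i)
      (fun _ _ => by positivity)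
      (by simp [hc]; field_simp)
      (fun o ho => by
        cases o with
        | none => exact prod_nonneg fun i _ => hσ i
        | some i => exact div_nonneg (sq_nonneg _) (hσ i))
    rw [prod_insertNone, sum_insertNone] at amgm
    simp only [Option.elim] at amgm
    rw [Real.finsetProd_rpow _ _ (fun i _ => div_nonneg (sq_nonneg _) (hσ i)), ← Real.mul_rpow
      (prod_nonneg fun i _ => hσ i) (prod_nonneg fun i _ => div_nonneg (sq_nonneg _) (hσ i)),
      ← prod_mul_distrib,
      prod_congr rfl (fun i hi => mul_div_cancel₀ (g S ^ 2) (hσpos i hi).ne'), prod_const, hc,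
      ← mul_sum] at amgm
    have e : ∑ i, (if i ∈ S then g S ^ 2 else 0) / σ i = ∑ i ∈ S, g S ^ 2 / σ i := by
      simp [ite_div, sum_ite_mem]
    rw [e, add_comm]
    refine le_trans ?_ amgm
    refine (Real.rpow_le_rpow_of_exponent_ge hgpos hg1 hp).trans (le_of_eq ?_)
    rw [← sq_abs (g S), ← pow_mul, ← Real.rpow_natCast, ← Real.rpow_mul hgpos.le]
    congr 1
    push_cast
    ring
  have h1 : ∑ S, ∑ i, (if i ∈ S then g S ^ 2 else 0) / σ i = ∑ i, σ i := by
    rw [sum_comm]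
    refine sum_congr rfl fun i _ => ?_
    rw [← sum_div]
    exact Real.div_sqrt
  have h2 : ∑ S : Finset ι, ∏ i ∈ S, σ i ≤ 3 := by
    calc ∑ S : Finset ι, ∏ i ∈ S, σ i = ∏ i, (1 + σ i) := by
          rw [prod_one_add, powerset_univ]
      _ ≤ ∏ i, Real.exp (σ i) := prod_le_prod (fun i _ => by linarith [hσ i])
          fun i _ => by linarith [Real.add_one_le_exp (σ i)]
      _ = Real.exp (∑ i, σ i) := (Real.exp_sum _ _).symm
      _ ≤ Real.exp 1 := Real.exp_le_exp.2 hA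
      _ ≤ 3 := by linarith [Real.exp_one_lt_d9]
  calc ∑ S, |g S| ^ p ≤ _ := sum_le_sum fun S _ => key S
    _ = 1 / (m + 1) * ∑ i, σ i + 1 / (m + 1) * ∑ S : Finset ι, ∏ i ∈ S, σ i := by
      rw [sum_add_distrib, ← mul_sum, ← mul_sum, h1]
    _ ≤ 1 / (m + 1) * 1 + 1 / (m + 1) * 3 := by gcongr
    _ ≤ 2 := by
      rw [← mul_add, one_div, inv_mul_le_iff₀ hm0]
      linarith

theorem sum_rpow_le_mixed_norm {ι : Type*} [Fintype ι] [DecidableEq ι] (m : ℕ) (hm : 1 ≤ m)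
    (g : Finset ι → ℝ) (hg : ∀ S, #S ≠ m → g S = 0) {A : ℝ}
    (hA : ∑ i, √(∑ S, if i ∈ S then g S ^ 2 else 0) ≤ A) {p : ℝ}
    (hp : 2 * (m : ℝ) / (m + 1) ≤ p) : ∑ S, |g S| ^ p ≤ 2 * A ^ p := by
  have hmR : (1 : ℝ) ≤ m := by exact_mod_cast hm
  have hp0 : 0 < p := lt_of_lt_of_le (by positivity) hp
  have hA0 : 0 ≤ A := (sum_nonneg fun i _ => Real.sqrt_nonneg _).trans hA
  rcases hA0.eq_or_lt with h0 | hpos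
  · have hz : ∀ S, g S = 0 := by
      intro S
      by_contra hne
      have hc : #S = m := by by_contra h; exact hne (hg S h)
      obtain ⟨i, hi⟩ := card_pos.1 (by omega : 0 < #S)
      have := (abs_le_sqrt_sum_sq_mem g hi).trans ((single_le_sum (fun i _ => Real.sqrt_nonneg
        (∑ S, if i ∈ S then g S ^ 2 else 0)) (mem_univ i)).trans hA)
      have := abs_pos.2 hne
      linarith
    simp only [hz, abs_zero, Real.zero_rpow hp0.ne', sum_const_zero]
    positivity
  · have := sum_rpow_le_two m hm (fun S => g S / A) (fun S h => by simp [hg S h]) (p := p) (by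
      have : ∀ i, √(∑ S, if i ∈ S then (g S / A) ^ 2 else 0) =
          √(∑ S, if i ∈ S then g S ^ 2 else 0) / A := fun i => by
        rw [← Real.sqrt_sq hA0, ← Real.sqrt_div' _ (sq_nonneg _), sum_div, Real.sqrt_sq hA0]
        congr 1
        refine sum_congr rfl fun S _ => ?_
        split_ifs <;> simp [div_pow]
      simp only [this, ← sum_div]
      exact (div_le_one hpos).2 hA) hp
    simp only [abs_div, abs_of_pos hpos, Real.div_rpow (abs_nonneg _) hA0, ← sum_div] at this
    exact (div_le_iff₀ (by positivity)).1 this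

/-- Coefficient bound obtained from directional derivatives at a vertex of the cube. -/
theorem sum_abs_walsh_mem_le {ι : Type*} [Fintype ι] [DecidableEq ι] (m : ℕ)
    (g : Finset ι → ℝ) (hg : ∀ S, #S ≠ m → g S = 0) {M : ℝ}
    (hM : ∀ x : ι → ℝ, (∀ i, |x i| ≤ 1) → |∑ S, g S * ∏ i ∈ S, x i| ≤ M) (T : Finset ι) :
    ∑ i, |∑ S, (if i ∈ S then g S else 0) * walsh T S| ≤ 10 ^ m * M := by
  set D : ι → ℝ := fun i => ∑ S, (if i ∈ S then g S else 0) * walsh T S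
  set ε : ι → ℝ := fun i => SignType.sign (D i)
  have hε : ∀ i, |ε i| ≤ 1 := fun i => by
    rcases lt_trichotomy (D i) 0 with h | h | h <;> simp [ε, h]
  have hεD : ∀ i, |D i| = ε i * D i := fun i => (sign_mul_self (D i)).symm
  have h := abs_coeff_one_le m
    (fun k => ∑ S, g S * walsh T S * ∑ U ∈ powersetCard k S, ∏ i ∈ U, ε i) (2 ^ m * M) (by
    intro v hv
    have e : ∑ k ∈ range (m + 2),
        (∑ S, g S * walsh T S * ∑ U ∈ powersetCard k S, ∏ i ∈ U, ε i) * v ^ k =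
        2 ^ m * ∑ S, g S * ∏ i ∈ S, ((if i ∈ T then -1 else 1) * ((1 + v * ε i) / 2)) := by
      simp only [sum_mul]
      rw [sum_comm, mul_sum]
      refine sum_congr rfl fun S _ => ?_
      by_cases hS : #S = m
      · rw [prod_mul_distrib, prod_div_distrib, prod_const, hS, prod_one_add, sum_powerset, hS,
          sum_range_succ _ (m + 1), powersetCard_eq_empty.2 (by omega)]
        simp only [prod_mul_distrib, prod_const, walsh]
        field_simp
        simp only [sum_empty, mul_zero, zero_mul, add_zero]
        rw [mul_sum]
        refine sum_congr rfl fun k _ => ?_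
        rw [mul_assoc, sum_mul]
        congr 1
        refine sum_congr rfl fun U hU => ?_
        rw [(mem_powersetCard.1 hU).2, mul_comm]
      · simp [hg S hS]
    rw [e, abs_mul, abs_of_nonneg (by positivity : (0 : ℝ) ≤ 2 ^ m)]
    gcongr
    refine hM _ fun i => ?_
    have h1 : |v * ε i| ≤ 1 := by
      rw [abs_mul]; exact mul_le_one₀ hv (abs_nonneg _) (hε i)
    have h2 := abs_le.1 h1
    have h3 : |(1 + v * ε i) / 2| ≤ 1 := by rw [abs_le]; constructor <;> linarith
    split_ifs <;> simpa using h3)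
  have e1 : ∑ i, |D i| = ∑ S, g S * walsh T S * ∑ U ∈ powersetCard 1 S, ∏ i ∈ U, ε i := by
    simp only [hεD, D, mul_sum]
    rw [sum_comm]
    refine sum_congr rfl fun S _ => ?_
    rw [powersetCard_one, sum_map]
    simp only [ite_mul, zero_mul, mul_ite, mul_zero, sum_ite_mem, univ_inter]
    refine sum_congr rfl fun i _ => ?_
    simp [mul_comm]
  rw [e1]
  refine (le_abs_self _).trans (h.trans (le_of_eq ?_))
  rw [← mul_assoc, ← mul_pow]
  norm_num

/-- The Bohnenblust–Hille inequality for homogeneous multilinear polynomials on the real cube. -/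
theorem sum_rpow_le_of_cube_bound {ι : Type*} [Fintype ι] [DecidableEq ι] (m : ℕ)
    (g : Finset ι → ℝ) (hg : ∀ S, #S ≠ m → g S = 0) {M : ℝ}
    (hM : ∀ x : ι → ℝ, (∀ i, |x i| ≤ 1) → |∑ S, g S * ∏ i ∈ S, x i| ≤ M) {p : ℝ} (hp0 : 0 < p)
    (hp : 2 * (m : ℝ) / (m + 1) ≤ p) : ∑ S, |g S| ^ p ≤ 2 * (30 ^ m * M) ^ p := by
  rcases Nat.eq_zero_or_pos m with rfl | hm
  · have h0 : ∀ S, S ≠ ∅ → g S = 0 := fun S hS => hg S (by simpa using hS)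
    have h1 := hM 0 (by simp)
    rw [sum_eq_single ∅ (fun S _ hS => by simp [h0 S hS]) (by simp)] at h1
    rw [sum_eq_single ∅ (fun S _ hS => by simp [h0 S hS, hp0.ne']) (by simp)]
    simp only [prod_empty, mul_one, pow_zero, one_mul] at h1 ⊢
    have h2 := Real.rpow_le_rpow (abs_nonneg _) h1 hp0.le
    have h3 := Real.rpow_nonneg (abs_nonneg (g ∅)) p
    linarith
  refine sum_rpow_le_mixed_norm m hm g hg ?_ hp
  have h1 : ∀ i : ι, 2 ^ Fintype.card ι * √(∑ S, if i ∈ S then g S ^ 2 else 0) ≤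
      3 ^ m * ∑ T : Finset ι, |∑ S, (if i ∈ S then g S else 0) * walsh T S| := fun i => by
    have := sqrt_sum_sq_le_sum_abs_walsh univ m (fun S => if i ∈ S then g S else 0)
      (fun S hS => by simp [hg S hS])
    simpa [powerset_univ, ite_pow] using this
  have h2 := sum_le_sum fun i (_ : i ∈ (univ : Finset ι)) => h1 i
  rw [← mul_sum, ← mul_sum, sum_comm] at h2
  have h3 : ∑ T : Finset ι, ∑ i, |∑ S, (if i ∈ S then g S else 0) * walsh T S| ≤
      2 ^ Fintype.card ι * (10 ^ m * M) := by
    refine (sum_le_sum fun T _ => sum_abs_walsh_mem_le m g hg hM T).trans (le_of_eq ?_)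
    simp
  have h4 : (2 : ℝ) ^ Fintype.card ι * ∑ i, √(∑ S, if i ∈ S then g S ^ 2 else 0) ≤
      2 ^ Fintype.card ι * (30 ^ m * M) :=
    calc _ ≤ _ := h2
      _ ≤ 3 ^ m * (2 ^ Fintype.card ι * (10 ^ m * M)) := by gcongr
      _ = _ := by rw [show (30 : ℝ) = 3 * 10 by norm_num, mul_pow]; ring
  exact le_of_mul_le_mul_left h4 (by positivity)

theorem mem_msupp {n K : ℕ} {α : Fin n → Fin K} {j : Fin n} : j ∈ msupp α ↔ (α j : ℕ) ≠ 0 := by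
  simp [msupp]

theorem card_msupp_eq_le {n K : ℕ} [NeZero K] (S : Finset (Fin n)) :
    #{α : Fin n → Fin K | msupp α = S} ≤ K ^ #S := by
  have hsub : ({α : Fin n → Fin K | msupp α = S} : Finset _) ⊆
      Fintype.piFinset fun j => if j ∈ S then univ else {0} := by
    intro α hα
    rw [mem_filter] at hα
    refine Fintype.mem_piFinset.2 fun j => ?_
    split_ifs with hj
    · exact mem_univ _
    · rw [← hα.2, mem_msupp, not_not] at hj
      exact mem_singleton.2 (Fin.ext (by simpa using hj))
  refine (card_le_card hsub).trans (le_of_eq ?_)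
  rw [Fintype.card_piFinset]
  simp [apply_ite card, prod_ite_mem]

theorem IsPrimitiveRoot.sum_pow_mul_inv_pow {K : ℕ} {ω : ℂ} (hω : IsPrimitiveRoot ω K)
    (a b : Fin K) : ∑ k : Fin K, ω ^ ((k : ℕ) * b) * ω⁻¹ ^ ((k : ℕ) * a) =
      if a = b then (K : ℂ) else 0 := by
  have hK : K ≠ 0 := a.pos.ne'
  have hω0 : ω ≠ 0 := hω.ne_zero hK
  have e : ∀ k : ℕ, ω ^ (k * b) * ω⁻¹ ^ (k * a) = (ω ^ (b : ℕ) * ω⁻¹ ^ (a : ℕ)) ^ k := fun k => by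
    rw [mul_pow, ← pow_mul, ← pow_mul, mul_comm k, mul_comm k]
  simp only [e]
  split_ifs with h
  · subst h
    simp [hω0]
  · rw [Fin.sum_univ_eq_sum_range fun k => (ω ^ (b : ℕ) * ω⁻¹ ^ (a : ℕ)) ^ k, geom_sum_eq]
    · rw [mul_pow, ← pow_mul, ← pow_mul, mul_comm _ K, mul_comm _ K, pow_mul, pow_mul, inv_pow,
        hω.pow_eq_one]
      simp
    · intro h1
      rw [inv_pow, mul_inv_eq_one₀ (pow_ne_zero _ hω0)] at h1
      exact h (Fin.ext (hω.pow_inj b.2 a.2 h1)).symm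

theorem IsPrimitiveRoot.sum_pow_mul {K : ℕ} [NeZero K] {ω : ℂ} (hω : IsPrimitiveRoot ω K)
    (b : Fin K) : ∑ k : Fin K, ω ^ ((k : ℕ) * b) = if (b : ℕ) = 0 then (K : ℂ) else 0 := by
  have := hω.sum_pow_mul_inv_pow 0 b
  rw [if_congr (eq_comm (a := (0 : Fin K))) rfl rfl] at this
  simpa using this

theorem IsPrimitiveRoot.sum_inv_pow_mul {K : ℕ} [NeZero K] {ω : ℂ} (hω : IsPrimitiveRoot ω K)
    (a : Fin K) : ∑ k : Fin K, ω⁻¹ ^ ((k : ℕ) * a) = if (a : ℕ) = 0 then (K : ℂ) else 0 := by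
  have := hω.sum_pow_mul_inv_pow a 0
  simpa using this

/-- Coefficients of the multilinear polynomial obtained from `∑ α, c α * z ^ α` by letting each
`z j` be distributed as the uniform measure plus `x j / K` times the difference of the point
masses at `ω ^ b j` and at `1`. -/
noncomputable def segmentCoeff {n K : ℕ} (ω : ℂ) (c : (Fin n → Fin K) → ℂ) (b : Fin n → Fin K)
    (S : Finset (Fin n)) : ℂ :=
  ∑ α with msupp α = S, c α * ∏ j ∈ S, (ω ^ ((b j : ℕ) * α j) - 1) / K

theorem segmentCoeff_eq_zero {n K m : ℕ} {ω : ℂ} {c : (Fin n → Fin K) → ℂ}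
    (hc : ∀ α, #(msupp α) ≠ m → c α = 0) (b : Fin n → Fin K) {S : Finset (Fin n)} (hS : #S ≠ m) :
    segmentCoeff ω c b S = 0 := by
  refine sum_eq_zero fun α hα => ?_
  rw [mem_filter] at hα
  rw [hc α (hα.2 ▸ hS), zero_mul]

theorem norm_sum_segmentCoeff_le {n K : ℕ} [NeZero K] {ω : ℂ} (hω : IsPrimitiveRoot ω K)
    (c : (Fin n → Fin K) → ℂ) {M : ℝ}
    (hM : ∀ z : Fin n → ℂ, (∀ j, z j ^ K = 1) → ‖∑ α, c α * ∏ j, z j ^ (α j : ℕ)‖ ≤ M)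
    (b : Fin n → Fin K) (x : Fin n → ℝ) (hx : ∀ j, |x j| ≤ 1) :
    ‖∑ S, segmentCoeff ω c b S * ∏ j ∈ S, (x j : ℂ)‖ ≤ M := by
  have hK : (K : ℂ) ≠ 0 := Nat.cast_ne_zero.2 (NeZero.ne K)
  have hKR : (0 : ℝ) < K := Nat.cast_pos.2 (NeZero.pos K)
  set w : Fin n → Fin K → ℝ := fun j k =>
    (1 + x j * ((if k = b j then 1 else 0) - if k = 0 then 1 else 0)) / K
  have hw : ∀ j k, 0 ≤ w j k := fun j k => by
    have := abs_le.1 (hx j)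
    refine div_nonneg ?_ hKR.le
    split_ifs <;> linarith
  have hw1 : ∀ j, ∑ k, w j k = 1 := fun j => by
    simp only [w, ← sum_div, sum_add_distrib, ← mul_sum, sum_sub_distrib]
    simp [hKR.ne']
  have hsum : ∀ j (a : Fin K), ∑ k : Fin K, (w j k : ℂ) * (ω ^ (k : ℕ)) ^ (a : ℕ) =
      if (a : ℕ) ≠ 0 then (ω ^ ((b j : ℕ) * a) - 1) / K * x j else 1 := fun j a => by
    have e : ∀ k : Fin K, (w j k : ℂ) * (ω ^ (k : ℕ)) ^ (a : ℕ) =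
        (ω ^ ((k : ℕ) * a) + x j * ((if k = b j then ω ^ ((k : ℕ) * a) else 0) -
          if k = 0 then ω ^ ((k : ℕ) * a) else 0)) / K := fun k => by
      rw [← pow_mul]
      simp only [w]
      split_ifs <;> push_cast <;> ring
    simp only [e, ← sum_div, sum_add_distrib, ← mul_sum, sum_sub_distrib, hω.sum_pow_mul]
    by_cases ha : (a : ℕ) = 0
    · simp [ha, hK]
    · simp [ha]
      ring
  have key : ∑ S, segmentCoeff ω c b S * ∏ j ∈ S, (x j : ℂ) =
      ∑ k : Fin n → Fin K, ((∏ j, w j (k j) : ℝ) : ℂ) *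
        ∑ α, c α * ∏ j, (ω ^ (k j : ℕ)) ^ (α j : ℕ) := by
    simp only [mul_sum]
    rw [sum_comm, ← sum_fiberwise univ msupp]
    refine sum_congr rfl fun S _ => ?_
    rw [segmentCoeff, sum_mul]
    refine sum_congr rfl fun α hα => ?_
    rw [mem_filter] at hα
    have e : ∀ k : Fin n → Fin K, ((∏ j, w j (k j) : ℝ) : ℂ) *
        (c α * ∏ j, (ω ^ (k j : ℕ)) ^ (α j : ℕ)) =
        c α * ∏ j, ((w j (k j) : ℂ) * (ω ^ (k j : ℕ)) ^ (α j : ℕ)) := fun k => by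
      rw [prod_mul_distrib]; push_cast; ring
    simp only [e, ← mul_sum]
    have := prod_univ_sum (fun _ : Fin n => (univ : Finset (Fin K)))
      fun j k => (w j k : ℂ) * (ω ^ (k : ℕ)) ^ (α j : ℕ)
    rw [Fintype.piFinset_univ] at this
    rw [← this]
    simp only [hsum]
    rw [← prod_filter, mul_assoc, ← prod_mul_distrib, ← hα.2, msupp]
  rw [key]
  have htot : ∑ k : Fin n → Fin K, ∏ j, w j (k j) = 1 := by
    have := prod_univ_sum (fun _ : Fin n => (univ : Finset (Fin K))) w
    rw [Fintype.piFinset_univ] at this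
    simp [← this, hw1]
  calc _ ≤ ∑ k : Fin n → Fin K, (∏ j, w j (k j)) * M := by
        refine norm_sum_le_of_le _ fun k _ => ?_
        have h0 : 0 ≤ ∏ j, w j (k j) := prod_nonneg fun j _ => hw _ _
        rw [norm_mul, Complex.norm_of_nonneg h0]
        refine mul_le_mul_of_nonneg_left (hM _ fun j => ?_) h0
        rw [← pow_mul, mul_comm, pow_mul, hω.pow_eq_one, one_pow]
    _ = M := by rw [← sum_mul, htot, one_mul]

theorem sum_segmentCoeff_mul_inv {n K : ℕ} [NeZero K] {ω : ℂ} (hω : IsPrimitiveRoot ω K)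
    (c : (Fin n → Fin K) → ℂ) (α : Fin n → Fin K) :
    (K : ℂ) ^ #(msupp α) * ∑ b, segmentCoeff ω c b (msupp α) * ∏ j, ω⁻¹ ^ ((b j : ℕ) * α j) =
      K ^ n * c α := by
  have hK : (K : ℂ) ≠ 0 := Nat.cast_ne_zero.2 (NeZero.ne K)
  have hfac : ∀ β : Fin n → Fin K, msupp β = msupp α → ∀ j,
      ∑ k : Fin K, (if j ∈ msupp α then (ω ^ ((k : ℕ) * β j) - 1) / K else 1) *
        ω⁻¹ ^ ((k : ℕ) * α j) =
      if α j = β j then (if j ∈ msupp α then 1 else (K : ℂ)) else 0 := by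
    intro β hβ j
    by_cases hj : j ∈ msupp α
    · simp only [hj, if_true, div_mul_eq_mul_div, sub_mul, one_mul, ← sum_div, sum_sub_distrib,
        hω.sum_pow_mul_inv_pow, hω.sum_inv_pow_mul, if_neg (mem_msupp.1 hj)]
      split_ifs <;> simp [hK]
    · have h1 : (α j : ℕ) = 0 := by simpa [mem_msupp] using hj
      have h2 : (β j : ℕ) = 0 := by rw [← hβ] at hj; simpa [mem_msupp] using hj
      simp [hj, h1, Fin.ext_iff, h2]
  have hprod : ∀ β : Fin n → Fin K, msupp β = msupp α →
      ∑ b : Fin n → Fin K, (∏ j ∈ msupp α, (ω ^ ((b j : ℕ) * β j) - 1) / K) *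
        ∏ j, ω⁻¹ ^ ((b j : ℕ) * α j) =
      if β = α then ∏ j, (if j ∈ msupp α then 1 else (K : ℂ)) else 0 := by
    intro β hβ
    have := prod_univ_sum (fun _ : Fin n => (univ : Finset (Fin K))) fun j k =>
      (if j ∈ msupp α then (ω ^ ((k : ℕ) * β j) - 1) / (K : ℂ) else 1) * ω⁻¹ ^ ((k : ℕ) * α j)
    rw [Fintype.piFinset_univ] at this
    simp only [hfac β hβ, prod_mul_distrib, prod_ite_mem, univ_inter] at this
    rw [← this]
    split_ifs with h
    · subst h; simp
    · obtain ⟨j, hj⟩ := Function.ne_iff.1 h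
      exact prod_eq_zero (mem_univ j) (if_neg (Ne.symm hj))
  have hmain : ∑ b, segmentCoeff ω c b (msupp α) * ∏ j, ω⁻¹ ^ ((b j : ℕ) * α j) =
      c α * ∏ j, (if j ∈ msupp α then 1 else (K : ℂ)) := by
    simp only [segmentCoeff, sum_mul, mul_assoc]
    rw [sum_comm]
    calc _ = ∑ β with msupp β = msupp α, if β = α then
          c α * ∏ j, (if j ∈ msupp α then 1 else (K : ℂ)) else 0 := by
          refine sum_congr rfl fun β hβ => ?_
          rw [← mul_sum, hprod β (mem_filter.1 hβ).2]
          split_ifs with h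
          · rw [h]
          · rw [mul_zero]
      _ = _ := by rw [sum_ite_eq' _ α]; simp
  have hpow : (K : ℂ) ^ #(msupp α) * ∏ j, (if j ∈ msupp α then 1 else (K : ℂ)) = K ^ n := by
    rw [← prod_const, ← univ_inter (msupp α), ← prod_ite_mem, univ_inter, ← prod_mul_distrib]
    calc _ = ∏ _j : Fin n, (K : ℂ) := prod_congr rfl fun j _ => by split_ifs <;> simp
      _ = _ := by simp
  rw [hmain, mul_left_comm, hpow, mul_comm]

theorem norm_rpow_le_mean_segmentCoeff {n K : ℕ} [NeZero K] {ω : ℂ} (hω : IsPrimitiveRoot ω K)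
    (c : (Fin n → Fin K) → ℂ) (α : Fin n → Fin K) {p : ℝ} (hp : 1 ≤ p) :
    ‖c α‖ ^ p ≤ ((K : ℝ) ^ #(msupp α)) ^ p *
      ∑ b, ((K : ℝ) ^ n)⁻¹ * ‖segmentCoeff ω c b (msupp α)‖ ^ p := by
  have hKR : (0 : ℝ) < K := Nat.cast_pos.2 (NeZero.pos K)
  have hn : ‖ω⁻¹‖ = 1 := by
    rw [norm_inv, Complex.norm_eq_one_of_pow_eq_one hω.pow_eq_one (NeZero.ne K), inv_one]
  have h : ‖c α‖ ≤ (K : ℝ) ^ #(msupp α) *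
      ∑ b, ((K : ℝ) ^ n)⁻¹ * ‖segmentCoeff ω c b (msupp α)‖ := by
    have h1 := congrArg norm (sum_segmentCoeff_mul_inv hω c α)
    rw [norm_mul, norm_mul, norm_pow, norm_pow, Complex.norm_natCast] at h1
    rw [← mul_sum, mul_left_comm, le_inv_mul_iff₀ (by positivity), ← h1]
    gcongr
    refine norm_sum_le_of_le _ fun b _ => ?_
    rw [norm_mul, norm_prod]
    simp only [norm_pow, hn, one_pow, prod_const_one, mul_one, le_refl]
  refine (Real.rpow_le_rpow (norm_nonneg _) h (by linarith)).trans ?_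
  rw [Real.mul_rpow (by positivity) (sum_nonneg fun _ _ => by positivity)]
  gcongr
  refine Real.rpow_arith_mean_le_arith_mean_rpow _ _ _ (fun _ _ => by positivity) ?_
    (fun _ _ => norm_nonneg _) hp
  simp [hKR.ne']

theorem Complex.norm_rpow_le_re_im (z : ℂ) {p : ℝ} (hp0 : 0 ≤ p) (hp : p ≤ 2) :
    ‖z‖ ^ p ≤ 4 * (|z.re| ^ p + |z.im| ^ p) := by
  have h1 : ‖z‖ ≤ 2 * max |z.re| |z.im| := by
    refine (Complex.norm_le_abs_re_add_abs_im z).trans ?_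
    linarith [le_max_left |z.re| |z.im|, le_max_right |z.re| |z.im|]
  have h2 : (2 : ℝ) ^ p ≤ 4 := by
    refine (Real.rpow_le_rpow_of_exponent_le (by norm_num) hp).trans (by norm_num)
  have h3 : (max |z.re| |z.im|) ^ p ≤ |z.re| ^ p + |z.im| ^ p := by
    rcases max_choice |z.re| |z.im| with h | h <;> rw [h]
    · exact le_add_of_nonneg_right (by positivity)
    · exact le_add_of_nonneg_left (by positivity)
  refine (Real.rpow_le_rpow (norm_nonneg _) h1 hp0).trans ?_
  rw [Real.mul_rpow (by norm_num) (by positivity)]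
  gcongr

theorem sum_norm_segmentCoeff_rpow_le {n K m : ℕ} [NeZero K] {ω : ℂ} (hω : IsPrimitiveRoot ω K)
    (c : (Fin n → Fin K) → ℂ) (hc : ∀ α, #(msupp α) ≠ m → c α = 0) {M : ℝ}
    (hM : ∀ z : Fin n → ℂ, (∀ j, z j ^ K = 1) → ‖∑ α, c α * ∏ j, z j ^ (α j : ℕ)‖ ≤ M)
    (b : Fin n → Fin K) {p : ℝ} (hp0 : 0 < p) (hp2 : p ≤ 2) (hp : 2 * (m : ℝ) / (m + 1) ≤ p) :
    ∑ S, ‖segmentCoeff ω c b S‖ ^ p ≤ 16 * (30 ^ m * M) ^ p := by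
  have hb := norm_sum_segmentCoeff_le hω c hM b
  have hcast : ∀ x : Fin n → ℝ, ∀ S : Finset (Fin n), ∏ j ∈ S, (x j : ℂ) =
      ((∏ j ∈ S, x j : ℝ) : ℂ) := fun x S => by push_cast; rfl
  have hre := sum_rpow_le_of_cube_bound m (fun S => (segmentCoeff ω c b S).re)
    (fun S hS => by simp [segmentCoeff_eq_zero hc b hS]) (M := M) (fun x hx => by
      have h := (Complex.abs_re_le_norm _).trans (hb x hx)
      simpa only [hcast, Complex.re_sum, Complex.re_mul_ofReal] using h) hp0 hp
  have him := sum_rpow_le_of_cube_bound m (fun S => (segmentCoeff ω c b S).im)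
    (fun S hS => by simp [segmentCoeff_eq_zero hc b hS]) (M := M) (fun x hx => by
      have h := (Complex.abs_im_le_norm _).trans (hb x hx)
      simpa only [hcast, Complex.im_sum, Complex.im_mul_ofReal] using h) hp0 hp
  calc _ ≤ _ := sum_le_sum fun S _ => Complex.norm_rpow_le_re_im _ hp0.le hp2
    _ ≤ _ := by
      rw [← mul_sum, sum_add_distrib]
      linarith

theorem sum_norm_rpow_le_of_support_card {n K m : ℕ} [NeZero K] (c : (Fin n → Fin K) → ℂ)
    (hc : ∀ α, #(msupp α) ≠ m → c α = 0) {M : ℝ}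
    (hM : ∀ z : Fin n → ℂ, (∀ j, z j ^ K = 1) → ‖∑ α, c α * ∏ j, z j ^ (α j : ℕ)‖ ≤ M)
    {p : ℝ} (hp1 : 1 ≤ p) (hp2 : p ≤ 2) (hp : 2 * (m : ℝ) / (m + 1) ≤ p) :
    ∑ α, ‖c α‖ ^ p ≤ 16 * K ^ m * ((30 * K) ^ m * M) ^ p := by
  have hω := Complex.isPrimitiveRoot_exp K (NeZero.ne K)
  set ω := Complex.exp (2 * Real.pi * Complex.I / K)
  have hKR : (0 : ℝ) < K := Nat.cast_pos.2 (NeZero.pos K)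
  have hp0 : 0 < p := by linarith
  have hM0 : 0 ≤ M := (norm_nonneg _).trans (hM (fun _ => 1) (by simp))
  have h1 : ∀ α, ‖c α‖ ^ p ≤ ((K : ℝ) ^ m) ^ p *
      ∑ b, ((K : ℝ) ^ n)⁻¹ * ‖segmentCoeff ω c b (msupp α)‖ ^ p := fun α => by
    by_cases h : #(msupp α) = m
    · exact h ▸ norm_rpow_le_mean_segmentCoeff hω c α hp1
    · rw [hc α h, norm_zero, Real.zero_rpow hp0.ne']
      positivity
  have h2 : ∀ b, ∑ α : Fin n → Fin K, ‖segmentCoeff ω c b (msupp α)‖ ^ p ≤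
      K ^ m * (16 * (30 ^ m * M) ^ p) := fun b => by
    rw [← sum_fiberwise univ msupp]
    refine le_trans ?_ (mul_le_mul_of_nonneg_left
      (sum_norm_segmentCoeff_rpow_le hω c hc hM b hp0 hp2 hp) (by positivity))
    rw [mul_sum]
    refine sum_le_sum fun S _ => ?_
    rw [sum_congr rfl (g := fun _ => ‖segmentCoeff ω c b S‖ ^ p)
      fun α hα => by rw [(mem_filter.1 hα).2], sum_const, nsmul_eq_mul]
    by_cases h : #S = m
    · gcongr
      exact_mod_cast h ▸ card_msupp_eq_le S
    · simp [segmentCoeff_eq_zero hc b h, hp0.ne']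
  calc ∑ α, ‖c α‖ ^ p ≤ _ := sum_le_sum fun α _ => h1 α
    _ = ((K : ℝ) ^ m) ^ p * ∑ b : Fin n → Fin K, ((K : ℝ) ^ n)⁻¹ *
        ∑ α : Fin n → Fin K, ‖segmentCoeff ω c b (msupp α)‖ ^ p := by
      rw [← mul_sum, sum_comm]
      simp only [mul_sum]
    _ ≤ ((K : ℝ) ^ m) ^ p * ∑ _b : Fin n → Fin K, ((K : ℝ) ^ n)⁻¹ *
        (K ^ m * (16 * (30 ^ m * M) ^ p)) := by
      gcongr with b
      exact h2 b
    _ = _ := by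
      rw [sum_const, nsmul_eq_mul, card_univ, Fintype.card_fun, Fintype.card_fin, Fintype.card_fin,
        mul_pow, mul_comm (30 ^ m : ℝ) (K ^ m : ℝ), mul_assoc (K ^ m : ℝ) (30 ^ m) M,
        Real.mul_rpow (x := (K : ℝ) ^ m) (by positivity) (by positivity)]
      push_cast
      field_simp

theorem norm_eval_le_iSup {n K : ℕ} (hK : K ≠ 0) (c : (Fin n → Fin K) → ℂ) (z : Fin n → ℂ)
    (hz : ∀ j, z j ^ K = 1) : ‖∑ α, c α * ∏ j, z j ^ (α j : ℕ)‖ ≤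
      ⨆ (z : Fin n → ℂ) (_ : ∀ j, z j ^ K = 1), ‖∑ α, c α * ∏ j, z j ^ (α j : ℕ)‖ := by
  have hbdd : BddAbove (Set.range fun z : Fin n → ℂ =>
      ⨆ (_ : ∀ j, z j ^ K = 1), ‖∑ α, c α * ∏ j, z j ^ (α j : ℕ)‖) := by
    refine ⟨∑ α, ‖c α‖, ?_⟩
    rintro _ ⟨z, rfl⟩
    refine Real.iSup_le (fun hz => norm_sum_le_of_le _ fun α _ => ?_) (by positivity)
    simp [norm_prod, norm_pow, fun j => Complex.norm_eq_one_of_pow_eq_one (hz j) hK]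
  exact (ciSup_pos (f := fun _ => ‖∑ α, c α * ∏ j, z j ^ (α j : ℕ)‖) hz).ge.trans
    (le_ciSup hbdd z)

/-- Support-homogeneous cyclic Bohnenblust–Hille inequality: for `K ≥ 3` there is `C_K > 0`
depending only on `K` such that for all `n ≥ 1`, `d ≥ 1`, `0 ≤ ℓ ≤ d`, and every
`ℓ`-support-homogeneous polynomial `f : Ω_Kⁿ → ℂ` of degree at most `d`,
`(∑_α |f̂(α)|^{2d/(d+1)})^{(d+1)/(2d)} ≤ C_K^d · sup_{z ∈ Ω_Kⁿ} |f(z)|`. -/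
theorem stmt17 (K : ℕ) (hK : 3 ≤ K) :
    ∃ CK : ℝ, 0 < CK ∧ ∀ n d ℓ : ℕ, 1 ≤ n → 1 ≤ d → ℓ ≤ d →
      ∀ c : (Fin n → Fin K) → ℂ,
        (∀ α : Fin n → Fin K, d < ∑ j, (α j : ℕ) → c α = 0) →
        (∀ α : Fin n → Fin K, (msupp α).card ≠ ℓ → c α = 0) →
        (∑ α : Fin n → Fin K, ‖c α‖ ^ ((2 * (d : ℝ)) / ((d : ℝ) + 1)))
            ^ (((d : ℝ) + 1) / (2 * (d : ℝ)))
          ≤ CK ^ d * ⨆ (z : Fin n → ℂ) (_ : ∀ j, z j ^ K = 1),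
              ‖∑ α : Fin n → Fin K, c α * ∏ j, z j ^ (α j : ℕ)‖ := by
  have hK0 : K ≠ 0 := by omega
  have : NeZero K := ⟨hK0⟩
  have hKR : (1 : ℝ) ≤ K := by exact_mod_cast (by omega : 1 ≤ K)
  refine ⟨16 * K * (30 * K), by positivity, fun n d ℓ _ hd hℓ c _ hc => ?_⟩
  have hM := norm_eval_le_iSup hK0 c
  set M := ⨆ (z : Fin n → ℂ) (_ : ∀ j, z j ^ K = 1), ‖∑ α, c α * ∏ j, z j ^ (α j : ℕ)‖
  have hM0 : 0 ≤ M := (norm_nonneg _).trans (hM (fun _ => 1) (by simp))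
  have hdR : (1 : ℝ) ≤ d := by exact_mod_cast hd
  have hℓR : (ℓ : ℝ) ≤ d := by exact_mod_cast hℓ
  have hp1 : 1 ≤ 2 * (d : ℝ) / (d + 1) := by rw [one_le_div (by positivity)]; linarith
  have hp2 : 2 * (d : ℝ) / (d + 1) ≤ 2 := by rw [div_le_iff₀ (by positivity)]; linarith
  have hp : 2 * (ℓ : ℝ) / (ℓ + 1) ≤ 2 * (d : ℝ) / (d + 1) := by
    rw [div_le_div_iff₀ (by positivity) (by positivity)]; linarith
  have main := sum_norm_rpow_le_of_support_card c hc hM hp1 hp2 hp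
  rw [← inv_div (2 * (d : ℝ))]
  set p := 2 * (d : ℝ) / (d + 1)
  have hp0 : 0 < p := by linarith
  have hbig : (1 : ℝ) ≤ 16 * K ^ ℓ := by linarith [one_le_pow₀ (n := ℓ) hKR]
  calc _ ≤ (16 * K ^ ℓ * ((30 * K) ^ ℓ * M) ^ p) ^ p⁻¹ :=
        Real.rpow_le_rpow (by positivity) main (by positivity)
    _ = (16 * K ^ ℓ) ^ p⁻¹ * ((30 * K) ^ ℓ * M) := by
        rw [Real.mul_rpow (by positivity) (by positivity), Real.rpow_rpow_inv (by positivity)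
          hp0.ne']
    _ ≤ (16 * K ^ ℓ) * ((30 * K) ^ ℓ * M) := by
        gcongr
        exact Real.rpow_le_self_of_one_le hbig (inv_le_one_of_one_le₀ hp1)
    _ ≤ (16 ^ d * K ^ d) * ((30 * K) ^ d * M) := by
        gcongr
        · exact le_self_pow₀ (by norm_num) (by omega)
        · linarith
    _ = (16 * K * (30 * K)) ^ d * M := by rw [mul_pow (16 * K : ℝ), mul_pow 16]; ring
end

section
/- Fix integers K ≥ 3 and d ≥ 1. There exists a constant C(d,K) > 0 depending only on d and K (independent of n) such that for every n ≥ 1 and every polynomial f : Ω_K^n → ℂ of degree at most d, writing f = ∑_{j=0}^{d} f_j where f_j(z) = ∑_{α : |supp(α)| = j} f̂(α) z^α is the j-support-homogeneous part of f, one has sup_{z ∈ Ω_K^n} |f_j(z)| ≤ C(d,K) · sup_{z ∈ Ω_K^n} |f(z)| for every 0 ≤ j ≤ d. Moreover, if K is prime, the constant can be taken of the form C_K^{d²} for some C_K depending only on K. -/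
open Finset

/-- The value at `z` of the polynomial with coefficients `c`. -/
noncomputable def polyEval {n K : ℕ} (c : (Fin n → Fin K) → ℂ) (z : Fin n → ℂ) : ℂ :=
  ∑ α : Fin n → Fin K, c α * ∏ i, z i ^ (α i : ℕ)

/-- The polynomial with coefficients `c` is bounded by `M` on `Ω_Kⁿ`. -/
def BoundedOnRoots {n K : ℕ} (c : (Fin n → Fin K) → ℂ) (M : ℝ) : Prop :=
  ∀ z : Fin n → ℂ, (∀ i, z i ^ K = 1) → ‖polyEval c z‖ ≤ M

lemma IsPrimitiveRoot.sum_pow_mul_eq {K : ℕ} {ζ : ℂ} (hζ : IsPrimitiveRoot ζ K) {a : ℕ}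
    (ha : a < K) : ∑ k ∈ range K, (ζ ^ k) ^ a = if a = 0 then (K : ℂ) else 0 := by
  split_ifs with h
  · simp [h]
  · have h1 : ζ ^ a ≠ 1 := hζ.pow_ne_one_of_pos_of_lt h ha
    have h2 := mul_geom_sum (ζ ^ a) K
    rw [← pow_mul, mul_comm a K, pow_mul, hζ.pow_eq_one, one_pow, sub_self] at h2
    simpa only [← pow_mul, mul_comm a] using (mul_eq_zero.mp h2).resolve_left (sub_ne_zero.mpr h1)

lemma polyEval_mulSingle {n K : ℕ} (c : (Fin n → Fin K) → ℂ) (z : Fin n → ℂ) (i : Fin n)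
    (w : ℂ) : polyEval c (z * Pi.mulSingle i w) =
      ∑ α : Fin n → Fin K, w ^ (α i : ℕ) * (c α * ∏ j, z j ^ (α j : ℕ)) := by
  refine sum_congr rfl fun α _ => ?_
  have h : ∏ j, (Pi.mulSingle i w : Fin n → ℂ) j ^ (α j : ℕ) = w ^ (α i : ℕ) := by
    rw [prod_eq_single i]
    · simp
    · intro j _ hj
      simp [Pi.mulSingle_eq_of_ne hj]
    · simp
  simp only [Pi.mul_apply, mul_pow, prod_mul_distrib, h]
  ring

lemma BoundedOnRoots.noise_coord {n K : ℕ} (hK : K ≠ 0) {c : (Fin n → Fin K) → ℂ} {M : ℝ}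
    (h : BoundedOnRoots c M) (i : Fin n) :
    BoundedOnRoots (fun α => (if (α i : ℕ) ≠ 0 then 1 / 2 else 1) * c α) M := by
  intro z hz
  obtain ⟨ζ, hζ⟩ : ∃ ζ : ℂ, IsPrimitiveRoot ζ K := ⟨_, Complex.isPrimitiveRoot_exp K hK⟩
  have hK' : (K : ℂ) ≠ 0 := Nat.cast_ne_zero.mpr hK
  have hKr : (0 : ℝ) < K := Nat.cast_pos.mpr (Nat.pos_of_ne_zero hK)
  have key : polyEval (fun α => (if (α i : ℕ) ≠ 0 then 1 / 2 else 1) * c α) z =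
      1 / 2 * polyEval c z +
        1 / 2 * ((K : ℂ)⁻¹ * ∑ k ∈ range K, polyEval c (z * Pi.mulSingle i (ζ ^ k))) := by
    simp only [polyEval_mulSingle]
    rw [sum_comm]
    simp only [← sum_mul, hζ.sum_pow_mul_eq (Fin.is_lt _)]
    simp only [polyEval, mul_sum, ← sum_add_distrib]
    refine sum_congr rfl fun α _ => ?_
    by_cases h0 : (α i : ℕ) = 0
    · simp only [h0, ne_eq, not_true_eq_false, if_false, if_true]
      field_simp
      ring
    · simp only [h0, ne_eq, not_false_eq_true, if_false, if_true]
      ring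
  have hb : ∀ k ∈ range K, ‖polyEval c (z * Pi.mulSingle i (ζ ^ k))‖ ≤ M := by
    intro k _
    refine h _ fun j => ?_
    rw [Pi.mul_apply, mul_pow, hz, one_mul]
    by_cases hj : j = i
    · subst hj
      rw [Pi.mulSingle_eq_same, ← pow_mul, mul_comm, pow_mul, hζ.pow_eq_one, one_pow]
    · simp [Pi.mulSingle_eq_of_ne hj]
  have hs : ‖∑ k ∈ range K, polyEval c (z * Pi.mulSingle i (ζ ^ k))‖ ≤ K * M := by
    simpa using norm_sum_le_of_le _ hb
  have hs' : (K : ℝ)⁻¹ * ‖∑ k ∈ range K, polyEval c (z * Pi.mulSingle i (ζ ^ k))‖ ≤ M := by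
    rwa [inv_mul_le_iff₀ hKr]
  rw [key]
  refine (norm_add_le _ _).trans ?_
  simp only [norm_mul, norm_inv, Complex.norm_natCast, norm_div, norm_one, Complex.norm_ofNat]
  linarith [h z hz]

lemma BoundedOnRoots.noise {n K : ℕ} (hK : K ≠ 0) {c : (Fin n → Fin K) → ℂ} {M : ℝ}
    (h : BoundedOnRoots c M) :
    BoundedOnRoots (fun α => (1 / 2) ^ (msupp α).card * c α) M := by
  have aux : ∀ s : Finset (Fin n), BoundedOnRoots
      (fun α => (∏ i ∈ s, if (α i : ℕ) ≠ 0 then (1 / 2 : ℂ) else 1) * c α) M := by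
    intro s
    induction s using Finset.induction_on with
    | empty => simpa using h
    | insert i s hi ih =>
      simpa only [prod_insert hi, mul_assoc] using ih.noise_coord hK i
  simpa only [msupp, prod_ite, prod_const, one_pow, mul_one] using aux univ

lemma BoundedOnRoots.prod_noise_sub {n K : ℕ} (hK : K ≠ 0) {c : (Fin n → Fin K) → ℂ} {M : ℝ}
    (h : BoundedOnRoots c M) (s : Finset ℕ) :
    BoundedOnRoots
      (fun α => (∏ i ∈ s, ((1 / 2 : ℂ) ^ (msupp α).card - (1 / 2) ^ i)) * c α)
      (2 ^ s.card * M) := by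
  induction s using Finset.induction_on with
  | empty => simpa using h
  | insert i s hi ih =>
    intro z hz
    have h1 := ih z hz
    have h2 := ih.noise hK z hz
    have key : polyEval (fun α => (∏ i ∈ insert i s,
        ((1 / 2 : ℂ) ^ (msupp α).card - (1 / 2) ^ i)) * c α) z =
        polyEval (fun α => (1 / 2) ^ (msupp α).card *
          ((∏ i ∈ s, ((1 / 2 : ℂ) ^ (msupp α).card - (1 / 2) ^ i)) * c α)) z -
        (1 / 2) ^ i * polyEval (fun α =>
          (∏ i ∈ s, ((1 / 2 : ℂ) ^ (msupp α).card - (1 / 2) ^ i)) * c α) z := by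
      simp only [polyEval, mul_sum, ← sum_sub_distrib, prod_insert hi]
      refine sum_congr rfl fun α _ => ?_
      ring
    rw [key, card_insert_of_notMem hi]
    refine (norm_sub_le _ _).trans ?_
    have h3 : ‖((1 / 2 : ℂ) ^ i)‖ ≤ 1 := by
      rw [norm_pow]
      exact pow_le_one₀ (norm_nonneg _) (by norm_num)
    rw [norm_mul]
    have h4 := mul_le_mul h3 h1 (norm_nonneg _) zero_le_one
    rw [pow_succ]
    linarith

lemma le_norm_half_pow_sub {d i j : ℕ} (hi : i ≤ d) (hj : j ≤ d) (hij : i ≠ j) :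
    (1 / 2 : ℝ) ^ (d + 1) ≤ ‖(1 / 2 : ℂ) ^ j - (1 / 2) ^ i‖ := by
  wlog hlt : j < i generalizing i j
  · rw [norm_sub_rev]
    exact this hj hi hij.symm (by omega)
  have hcast : (1 / 2 : ℂ) ^ j - (1 / 2) ^ i = (((1 / 2 : ℝ) ^ j - (1 / 2) ^ i : ℝ) : ℂ) := by
    push_cast
    rfl
  have h1 : (1 / 2 : ℝ) ^ i ≤ (1 / 2) ^ (j + 1) :=
    pow_le_pow_of_le_one (by norm_num) (by norm_num) hlt
  have h2 : (1 / 2 : ℝ) ^ (d + 1) ≤ (1 / 2) ^ (j + 1) :=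
    pow_le_pow_of_le_one (by norm_num) (by norm_num) (by omega)
  rw [hcast, Complex.norm_real]
  refine le_trans ?_ (le_abs_self _)
  rw [pow_succ _ j] at h1 h2
  linarith

lemma card_msupp_le_sum {n K : ℕ} (α : Fin n → Fin K) : (msupp α).card ≤ ∑ j, (α j : ℕ) := by
  rw [card_eq_sum_ones]
  calc ∑ _ ∈ msupp α, 1 ≤ ∑ j ∈ msupp α, (α j : ℕ) :=
        sum_le_sum fun j hj => Nat.one_le_iff_ne_zero.mpr (mem_filter.mp hj).2
    _ ≤ ∑ j, (α j : ℕ) := sum_le_sum_of_subset (subset_univ _)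

lemma BoundedOnRoots.norm_supportPart_le {n K d : ℕ} (hK : K ≠ 0) (hd : 1 ≤ d)
    {c : (Fin n → Fin K) → ℂ} {M : ℝ} (h : BoundedOnRoots c M) (hM : 0 ≤ M)
    (hc : ∀ α : Fin n → Fin K, d < ∑ j, (α j : ℕ) → c α = 0) {j : ℕ} (hj : j ≤ d)
    {z : Fin n → ℂ} (hz : ∀ i, z i ^ K = 1) :
    ‖∑ α ∈ univ.filter (fun α : Fin n → Fin K => (msupp α).card = j),
      c α * ∏ i, z i ^ (α i : ℕ)‖ ≤ 8 ^ (d ^ 2) * M := by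
  set S : Finset ℕ := (range (d + 1)).erase j with hS
  have hcard : S.card = d := by
    rw [hS, card_erase_of_mem (mem_range.mpr (by omega)), card_range, Nat.add_sub_cancel]
  have hb := h.prod_noise_sub hK S z hz
  have key : polyEval (fun α => (∏ i ∈ S, ((1 / 2 : ℂ) ^ (msupp α).card - (1 / 2) ^ i)) * c α) z =
      (∏ i ∈ S, ((1 / 2 : ℂ) ^ j - (1 / 2) ^ i)) *
        ∑ α ∈ univ.filter (fun α : Fin n → Fin K => (msupp α).card = j),
          c α * ∏ i, z i ^ (α i : ℕ) := by
    rw [polyEval, mul_sum, sum_filter]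
    refine sum_congr rfl fun α _ => ?_
    split_ifs with hα
    · rw [hα, mul_assoc]
    · by_cases hdeg : d < ∑ j, (α j : ℕ)
      · simp [hc α hdeg]
      · have hmem : (msupp α).card ∈ S := by
          have := card_msupp_le_sum α
          exact mem_erase.mpr ⟨hα, mem_range.mpr (by omega)⟩
        rw [prod_eq_zero hmem (sub_self _)]
        simp
  rw [key, hcard, norm_mul, norm_prod] at hb
  have hprod : ((1 / 2 : ℝ) ^ (d + 1)) ^ d ≤ ∏ i ∈ S, ‖(1 / 2 : ℂ) ^ j - (1 / 2) ^ i‖ := by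
    rw [← hcard, ← prod_const, hcard]
    refine prod_le_prod (fun _ _ => by positivity) fun i hi => ?_
    rw [hS, mem_erase, mem_range] at hi
    exact le_norm_half_pow_sub (by omega) hj hi.1
  set X := ‖∑ α ∈ univ.filter (fun α : Fin n → Fin K => (msupp α).card = j),
      c α * ∏ i, z i ^ (α i : ℕ)‖
  have h1 : ((1 / 2 : ℝ) ^ (d + 1)) ^ d * X ≤ 2 ^ d * M :=
    (mul_le_mul_of_nonneg_right hprod (norm_nonneg _)).trans hb
  have h2 : X ≤ 2 ^ ((d + 1) * d) * (2 ^ d * M) := by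
    rwa [← pow_mul, one_div, inv_pow, inv_mul_le_iff₀ (by positivity)] at h1
  refine h2.trans ?_
  rw [← mul_assoc, ← pow_add]
  refine mul_le_mul_of_nonneg_right ?_ hM
  rw [show (8 : ℝ) = 2 ^ 3 by norm_num, ← pow_mul]
  exact pow_le_pow_right₀ (by norm_num) (by nlinarith)

lemma boundedOnRoots_sum_norm {n K : ℕ} (hK : K ≠ 0) (c : (Fin n → Fin K) → ℂ) :
    BoundedOnRoots c (∑ α, ‖c α‖) := by
  intro z hz
  refine norm_sum_le_of_le _ fun α _ => ?_
  simp [norm_prod, fun i => Complex.norm_eq_one_of_pow_eq_one (hz i) hK]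

lemma boundedOnRoots_iSup {n K : ℕ} (hK : K ≠ 0) (c : (Fin n → Fin K) → ℂ) :
    BoundedOnRoots c (⨆ (z : Fin n → ℂ) (_ : ∀ i, z i ^ K = 1), ‖polyEval c z‖) := by
  intro z hz
  have hbdd : BddAbove (Set.range fun z : Fin n → ℂ =>
      ⨆ (_ : ∀ i, z i ^ K = 1), ‖polyEval c z‖) := by
    refine ⟨∑ α, ‖c α‖, ?_⟩
    rintro _ ⟨w, rfl⟩
    exact Real.iSup_le (fun hw => boundedOnRoots_sum_norm hK c w hw)
      (sum_nonneg fun _ _ => norm_nonneg _)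
  refine le_trans ?_ (le_ciSup hbdd z)
  simp [hz]

lemma iSup_norm_supportPart_le {n K d : ℕ} (hK : K ≠ 0) (hd : 1 ≤ d)
    (c : (Fin n → Fin K) → ℂ)
    (hc : ∀ α : Fin n → Fin K, d < ∑ j, (α j : ℕ) → c α = 0) {j : ℕ} (hj : j ≤ d) :
    (⨆ (z : Fin n → ℂ) (_ : ∀ i, z i ^ K = 1),
        ‖∑ α ∈ univ.filter (fun α : Fin n → Fin K => (msupp α).card = j),
          c α * ∏ i, z i ^ (α i : ℕ)‖)
      ≤ 8 ^ (d ^ 2) * ⨆ (z : Fin n → ℂ) (_ : ∀ i, z i ^ K = 1),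
          ‖∑ α : Fin n → Fin K, c α * ∏ i, z i ^ (α i : ℕ)‖ := by
  have hM : 0 ≤ ⨆ (z : Fin n → ℂ) (_ : ∀ i, z i ^ K = 1), ‖polyEval c z‖ :=
    Real.iSup_nonneg fun _ => Real.iSup_nonneg fun _ => norm_nonneg _
  have hR := mul_nonneg (pow_nonneg (by norm_num : (0 : ℝ) ≤ 8) (d ^ 2)) hM
  exact Real.iSup_le (fun z => Real.iSup_le (fun hz =>
    (boundedOnRoots_iSup hK c).norm_supportPart_le hK hd hM hc hj hz) hR) hR

/-- Splitting lemma: for `K ≥ 3` and `d ≥ 1` there is `C(d,K) > 0`, independent of `n`, such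
that for every polynomial `f : Ω_Kⁿ → ℂ` of degree at most `d`, each `j`-support-homogeneous
part `f_j` (`0 ≤ j ≤ d`) satisfies `sup_{Ω_Kⁿ} |f_j| ≤ C(d,K) · sup_{Ω_Kⁿ} |f|`; moreover,
for prime `K` the constant can be taken of the form `C_K^{d²}` with `C_K` depending only
on `K`. -/
theorem stmt18 (K : ℕ) (hK : 3 ≤ K) :
    (∀ d : ℕ, 1 ≤ d →
      ∃ C : ℝ, 0 < C ∧ ∀ n : ℕ, 1 ≤ n → ∀ c : (Fin n → Fin K) → ℂ,
        (∀ α : Fin n → Fin K, d < ∑ j, (α j : ℕ) → c α = 0) →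
        ∀ j : ℕ, j ≤ d →
          (⨆ (z : Fin n → ℂ) (_ : ∀ i, z i ^ K = 1),
              ‖∑ α ∈ Finset.univ.filter (fun α : Fin n → Fin K => (msupp α).card = j),
                  c α * ∏ i, z i ^ (α i : ℕ)‖)
            ≤ C * ⨆ (z : Fin n → ℂ) (_ : ∀ i, z i ^ K = 1),
                ‖∑ α : Fin n → Fin K, c α * ∏ i, z i ^ (α i : ℕ)‖) ∧
    (Nat.Prime K →
      ∃ CK : ℝ, 0 < CK ∧ ∀ d : ℕ, 1 ≤ d → ∀ n : ℕ, 1 ≤ n → ∀ c : (Fin n → Fin K) → ℂ,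
        (∀ α : Fin n → Fin K, d < ∑ j, (α j : ℕ) → c α = 0) →
        ∀ j : ℕ, j ≤ d →
          (⨆ (z : Fin n → ℂ) (_ : ∀ i, z i ^ K = 1),
              ‖∑ α ∈ Finset.univ.filter (fun α : Fin n → Fin K => (msupp α).card = j),
                  c α * ∏ i, z i ^ (α i : ℕ)‖)
            ≤ CK ^ (d ^ 2) * ⨆ (z : Fin n → ℂ) (_ : ∀ i, z i ^ K = 1),
                ‖∑ α : Fin n → Fin K, c α * ∏ i, z i ^ (α i : ℕ)‖) := by
  have hK0 : K ≠ 0 := by omega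
  exact ⟨fun d hd => ⟨8 ^ (d ^ 2), by positivity, fun n _ c hc j hj =>
      iSup_norm_supportPart_le hK0 hd c hc hj⟩,
    fun _ => ⟨8, by norm_num, fun d hd n _ c hc j hj =>
      iSup_norm_supportPart_le hK0 hd c hc hj⟩⟩
end

section
/- Fix an integer K ≥ 3 and let ω = e^{2πi/K} and √ω = e^{πi/K}. Let E be a set of multi-indices α ∈ {0,1,…,K−1}^n, all pairwise inseparable, i.e. there exist ℓ and τ ∈ ℂ such that |supp(α)| = ℓ and τ_α^{(ω)} = τ for every α ∈ E, where τ_α^{(ω)} = ∏_{j : α_j ≠ 0} (1 − ω^{α_j}). Then every polynomial g(z) = ∑_{α ∈ E} a_α z^α with complex coefficients satisfies |g(√ω, √ω, …, √ω)| ≤ sup_{z ∈ Ω_K^n} |g(z)|. -/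
open Finset

/-- For `a ≤ K`, the number `1 - e^{2πia/K}` is a nonnegative multiple of `-i e^{πia/K}`. -/
theorem one_sub_exp_pow_eq_norm_mul {K a : ℕ} (hK : K ≠ 0) (ha : a ≤ K) :
    1 - Complex.exp (2 * Real.pi * Complex.I / K) ^ a =
      ‖1 - Complex.exp (2 * Real.pi * Complex.I / K) ^ a‖ *
        (-Complex.I * Complex.exp (Real.pi * Complex.I / K) ^ a) := by
  have hK' : (0 : ℝ) < K := by positivity
  have hfac : 1 - Complex.exp (2 * Real.pi * Complex.I / K) ^ a =
      ((2 * Real.sin (Real.pi * a / K) : ℝ) : ℂ) *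
        (-Complex.I * Complex.exp (Real.pi * Complex.I / K) ^ a) := by
    rw [← Complex.exp_nat_mul, ← Complex.exp_nat_mul]
    push_cast
    rw [Complex.sin]
    have h1 : (a : ℂ) * (2 * Real.pi * Complex.I / K) =
        Real.pi * a / K * Complex.I + Real.pi * a / K * Complex.I := by ring
    have h2 : (a : ℂ) * (Real.pi * Complex.I / K) = Real.pi * a / K * Complex.I := by ring
    rw [h1, h2, neg_mul, Complex.exp_neg, Complex.exp_add]
    have h3 := Complex.exp_ne_zero (Real.pi * a / K * Complex.I)
    generalize Complex.exp (Real.pi * a / K * Complex.I) = x at h3 ⊢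
    field_simp
    linear_combination (1 - x ^ 2) * Complex.I_sq
  have hnorm : ‖Complex.exp (Real.pi * Complex.I / K) ^ a‖ = 1 := by
    have h : (Real.pi * Complex.I / K : ℂ) = ((Real.pi / K : ℝ) : ℂ) * Complex.I := by
      push_cast; ring
    rw [norm_pow, h, Complex.norm_exp_ofReal_mul_I, one_pow]
  have hsin : 0 ≤ Real.sin (Real.pi * a / K) := by
    apply Real.sin_nonneg_of_nonneg_of_le_pi
    · positivity
    · rw [div_le_iff₀ hK']
      gcongr
  have hn : ‖1 - Complex.exp (2 * Real.pi * Complex.I / K) ^ a‖ =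
      2 * Real.sin (Real.pi * a / K) := by
    rw [hfac, norm_mul, norm_mul, hnorm, norm_neg, Complex.norm_I, Complex.norm_real,
      Real.norm_of_nonneg (by positivity), mul_one, mul_one]
  rw [hn, hfac]

/-- The value of a monomial at `(√ω, …, √ω)` is determined by the size of its support and by
`∏_{j : α_j ≠ 0} (1 - ω^{α_j})`. -/
theorem prod_msupp_one_sub_exp_eq {K n : ℕ} (hK : K ≠ 0) (α : Fin n → Fin K) :
    ∏ j ∈ msupp α, (1 - Complex.exp (2 * Real.pi * Complex.I / K) ^ (α j : ℕ)) =
      ‖∏ j ∈ msupp α, (1 - Complex.exp (2 * Real.pi * Complex.I / K) ^ (α j : ℕ))‖ *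
        ((-Complex.I) ^ (msupp α).card *
          ∏ j, Complex.exp (Real.pi * Complex.I / K) ^ (α j : ℕ)) := by
  have hprod : ∏ j, Complex.exp (Real.pi * Complex.I / K) ^ (α j : ℕ) =
      ∏ j ∈ msupp α, Complex.exp (Real.pi * Complex.I / K) ^ (α j : ℕ) := by
    symm
    apply Finset.prod_subset (Finset.subset_univ _)
    intro j _ hj
    have h0 : (α j : ℕ) = 0 := by simpa [msupp] using hj
    rw [h0, pow_zero]
  rw [hprod, ← Finset.prod_const, ← Finset.prod_mul_distrib, norm_prod, Complex.ofReal_prod,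
    ← Finset.prod_mul_distrib]
  exact Finset.prod_congr rfl fun j _ => one_sub_exp_pow_eq_norm_mul hK (α j).isLt.le

theorem prod_msupp_one_sub_exp_ne_zero {K n : ℕ} (hK : K ≠ 0) (α : Fin n → Fin K) :
    ∏ j ∈ msupp α, (1 - Complex.exp (2 * Real.pi * Complex.I / K) ^ (α j : ℕ)) ≠ 0 := by
  refine Finset.prod_ne_zero_iff.mpr fun j hj => sub_ne_zero.mpr (Ne.symm ?_)
  have h0 : (α j : ℕ) ≠ 0 := by simpa [msupp] using hj
  exact (Complex.isPrimitiveRoot_exp K hK).pow_ne_one_of_pos_of_lt h0 (α j).isLt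

theorem bddAbove_range_norm_sum_on_roots {K n : ℕ} (hK : K ≠ 0)
    (E : Finset (Fin n → Fin K)) (a : (Fin n → Fin K) → ℂ) :
    BddAbove (Set.range fun z : Fin n → ℂ =>
      ⨆ (_ : ∀ j, z j ^ K = 1), ‖∑ α ∈ E, a α * ∏ j, z j ^ (α j : ℕ)‖) := by
  refine ⟨∑ α ∈ E, ‖a α‖, ?_⟩
  rintro _ ⟨z, rfl⟩
  refine Real.iSup_le (fun hz => ?_) (Finset.sum_nonneg fun _ _ => norm_nonneg _)
  refine (norm_sum_le _ _).trans (Finset.sum_le_sum fun α _ => ?_)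
  have hz1 : ∀ j, ‖z j‖ = 1 := fun j => Complex.norm_eq_one_of_pow_eq_one (hz j) hK
  simp [norm_prod, hz1]

/-- Boundedness at `(√ω, …, √ω)` for inseparable polynomials: let `K ≥ 3`, `ω = e^{2πi/K}`,
`√ω = e^{πi/K}`, and let `E` be a set of multi-indices which are pairwise inseparable, i.e.
there are `ℓ` and `τ` with `|supp α| = ℓ` and `τ_α^{(ω)} = ∏_{j : α_j ≠ 0}(1 - ω^{α_j}) = τ`
for all `α ∈ E`. Then every `g(z) = ∑_{α ∈ E} a_α z^α` satisfies
`|g(√ω, …, √ω)| ≤ sup_{z ∈ Ω_Kⁿ} |g(z)|`. -/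
theorem stmt19 (K n : ℕ) (hK : 3 ≤ K)
    (E : Finset (Fin n → Fin K)) (ℓ : ℕ) (τ : ℂ)
    (hsupp : ∀ α ∈ E, (msupp α).card = ℓ)
    (htau : ∀ α ∈ E,
      ∏ j ∈ msupp α, (1 - Complex.exp (2 * Real.pi * Complex.I / K) ^ (α j : ℕ)) = τ)
    (a : (Fin n → Fin K) → ℂ) :
    ‖∑ α ∈ E, a α * ∏ j, Complex.exp (Real.pi * Complex.I / K) ^ (α j : ℕ)‖
      ≤ ⨆ (z : Fin n → ℂ) (_ : ∀ j, z j ^ K = 1),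
          ‖∑ α ∈ E, a α * ∏ j, z j ^ (α j : ℕ)‖ := by
  have hK0 : K ≠ 0 := by omega
  obtain ⟨c, hc, hmon⟩ : ∃ c : ℂ, ‖c‖ ≤ 1 ∧
      ∀ α ∈ E, ∏ j, Complex.exp (Real.pi * Complex.I / K) ^ (α j : ℕ) = c := by
    refine ⟨τ / (‖τ‖ * (-Complex.I) ^ ℓ), ?_, fun α hα => ?_⟩
    · simpa using div_self_le_one ‖τ‖
    · have hτ : τ ≠ 0 := htau α hα ▸ prod_msupp_one_sub_exp_ne_zero hK0 α
      have h := prod_msupp_one_sub_exp_eq hK0 α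
      rw [htau α hα, hsupp α hα] at h
      rw [eq_div_iff (by simp [hτ])]
      linear_combination -h
  have hone : ‖∑ α ∈ E, a α‖ ≤ ⨆ (z : Fin n → ℂ) (_ : ∀ j, z j ^ K = 1),
      ‖∑ α ∈ E, a α * ∏ j, z j ^ (α j : ℕ)‖ := by
    simpa using le_ciSup (bddAbove_range_norm_sum_on_roots hK0 E a) 1
  refine le_trans ?_ hone
  rw [Finset.sum_congr rfl fun α hα => by rw [hmon α hα], ← Finset.sum_mul, norm_mul]
  exact mul_le_of_le_one_right (norm_nonneg _) hc
end
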